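/- Let k ≥ 2 and let (M_1, …, M_k) be an anarchy harmonious k-tuple with K = ω(M_1 ⋯ M_k), and let P be the set of all prime factors of M_1 ⋯ M_k. Then σ(M_1 ⋯ M_k) · Φ(P)/Π(P) ≤ F_K(Π(P)) · Π(P)^{−2}. -/

import Mathlib

/-- `sigma n` is the sum of all positive divisors of `n`. -/
def sigma (n : ℕ) : ℕ := ∑ d ∈ n.divisors, d

/-- `F r x = x ^ (2 ^ r) - x ^ (2 ^ (r - 1))` for `r ≥ 1`, and `F 0 x = x - 1`. -/
noncomputable def F (r : ℕ) (x : ℝ) : ℝ :=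
  if r = 0 then x - 1 else x ^ (2 ^ r) - x ^ (2 ^ (r - 1))

/-- `PiS S = ∏_{m ∈ S} m`. -/
def PiS (S : Finset ℕ) : ℕ := ∏ m ∈ S, m

/-- `PhiS S = ∏_{m ∈ S} (m - 1)`. -/
def PhiS (S : Finset ℕ) : ℕ := ∏ m ∈ S, (m - 1)

open Finset in
/-- Abel summation: a decreasing weighting of a sequence with nonnegative partial sums. -/
lemma mul_sum_le_sum_mul_of_antitone {c d : ℕ → ℝ} (hc : Antitone c) (n : ℕ)
    (hd : ∀ m ≤ n, 0 ≤ ∑ j ∈ range m, d j) :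
    c n * ∑ j ∈ range n, d j ≤ ∑ j ∈ range n, c j * d j := by
  induction n with
  | zero => simp
  | succ n ih =>
    have h₁ := ih fun m hm => hd m (hm.trans n.le_succ)
    have h₂ := mul_le_mul_of_nonneg_right (hc n.le_succ) (hd (n + 1) le_rfl)
    rw [sum_range_succ] at h₂ ⊢
    rw [sum_range_succ]
    linarith

lemma log_one_add_inv_sub_le {u v : ℝ} (hu : 0 < u) (hv : 0 < v) :
    1 / (1 + u) * (Real.log u - Real.log v) ≤
      Real.log (1 + 1 / v) - Real.log (1 + 1 / u) := by
  have h := strictConcaveOn_log_Ioi.concaveOn.2 (Set.mem_Ioi.2 one_pos)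
    (Set.mem_Ioi.2 (div_pos hv hu)) (show 0 ≤ 1 / (1 + u) by positivity)
    (show 0 ≤ u / (1 + u) by positivity) (by field_simp)
  simp only [smul_eq_mul, Real.log_one, mul_zero, zero_add, mul_one] at h
  have e₁ : 1 / (1 + u) + u / (1 + u) * (v / u) = (1 + v) / (1 + u) := by field_simp
  have e₂ : 1 + 1 / v = (1 + v) / v := by field_simp; ring
  have e₃ : 1 + 1 / u = (1 + u) / u := by field_simp; ring
  have e₄ : u / (1 + u) = 1 - 1 / (1 + u) := by field_simp; ring
  rw [e₁, e₄, Real.log_div hv.ne' hu.ne', Real.log_div (by positivity) (by positivity)] at h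
  rw [e₂, e₃, Real.log_div (by positivity) hv.ne', Real.log_div (by positivity) hu.ne']
  linarith

open Finset in
/-- A multiplicative weak majorization inequality for `∏ (1 + 1 / u j)`. -/
lemma prod_one_add_inv_lt_of_prod_le {u v : ℕ → ℝ} (hu : ∀ j, 0 < u j) (hv : ∀ j, 0 < v j)
    (hmono : Monotone u) (n : ℕ)
    (hle : ∀ m < n, ∏ j ∈ range m, v j ≤ ∏ j ∈ range m, u j)
    (hlt : ∏ j ∈ range n, v j < ∏ j ∈ range n, u j) :
    ∏ j ∈ range n, (1 + 1 / u j) < ∏ j ∈ range n, (1 + 1 / v j) := by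
  have hpu (m : ℕ) : 0 < ∏ j ∈ range m, u j := prod_pos fun j _ => hu j
  have hpv (m : ℕ) : 0 < ∏ j ∈ range m, v j := prod_pos fun j _ => hv j
  have hsum (m : ℕ) : ∑ j ∈ range m, (Real.log (u j) - Real.log (v j)) =
      Real.log (∏ j ∈ range m, u j) - Real.log (∏ j ∈ range m, v j) := by
    rw [sum_sub_distrib, Real.log_prod fun j _ => (hu j).ne',
      Real.log_prod fun j _ => (hv j).ne']
  have hpos : 0 < ∑ j ∈ range n, (Real.log (u j) - Real.log (v j)) := by
    rw [hsum, sub_pos]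
    exact Real.log_lt_log (hpv n) hlt
  have habel := mul_sum_le_sum_mul_of_antitone (c := fun j => 1 / (1 + u j))
    (d := fun j => Real.log (u j) - Real.log (v j))
    (fun i j hij => one_div_le_one_div_of_le (by linarith [hu i]) (by linarith [hmono hij])) n
    (fun m hm => by
      rcases hm.eq_or_lt with rfl | hm
      · exact hpos.le
      · rw [hsum, sub_nonneg]
        exact Real.log_le_log (hpv m) (hle m hm))
  have hc : 0 < 1 / (1 + u n) := by have := hu n; positivity
  have hlog : ∑ j ∈ range n, 1 / (1 + u j) * (Real.log (u j) - Real.log (v j)) ≤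
      ∑ j ∈ range n, (Real.log (1 + 1 / v j) - Real.log (1 + 1 / u j)) :=
    sum_le_sum fun j _ => log_one_add_inv_sub_le (hu j) (hv j)
  have hu' (j : ℕ) : 0 < 1 + 1 / u j := by have := hu j; positivity
  have hv' (j : ℕ) : 0 < 1 + 1 / v j := by have := hv j; positivity
  rw [← Real.log_lt_log_iff (prod_pos fun j _ => hu' j) (prod_pos fun j _ => hv' j),
    Real.log_prod fun j _ => (hu' j).ne', Real.log_prod fun j _ => (hv' j).ne', ← sub_pos,
    ← sum_sub_distrib]
  exact (mul_pos hc hpos).trans_le (habel.trans hlog)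

open Finset in
lemma mul_prod_pow_two_pow {R : Type*} [CommRing R] (b : R) (n : ℕ) :
    b * ∏ j ∈ range n, b ^ 2 ^ j = b ^ 2 ^ n := by
  induction n with
  | zero => simp
  | succ n ih => rw [prod_range_succ, ← mul_assoc, ih, ← pow_add]; congr 1; ring

open Finset in
lemma prod_one_add_inv_pow_two_pow {b : ℝ} (hb : 1 < b) (n : ℕ) :
    (b - 1) * ∏ j ∈ range n, (1 + 1 / b ^ 2 ^ j) = b * (1 - 1 / b ^ 2 ^ n) := by
  have hb0 : b ≠ 0 := by positivity
  induction n with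
  | zero => simp; field_simp
  | succ n ih =>
    rw [prod_range_succ, ← mul_assoc, ih, pow_succ, pow_mul]
    field_simp
    ring

open Finset in
/-- If `1 + 1 / u j` multiply to at least `b / (b - 1)`, then either some proper initial product
of the `u j`, or their whole product, is small. -/
lemma exists_prod_le_or_prod_le {u : ℕ → ℝ} (hu : ∀ j, 0 < u j) (hmono : Monotone u)
    {b : ℝ} (hb : 1 < b) (n : ℕ)
    (h : b ≤ (b - 1) * ∏ j ∈ range (n + 1), (1 + 1 / u j)) :
    (∃ l, 1 ≤ l ∧ l ≤ n ∧ b * ∏ j ∈ range l, u j ≤ b ^ 2 ^ l) ∨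
      b * ∏ j ∈ range (n + 1), u j ≤ b ^ 2 ^ (n + 1) - b ^ 2 ^ n := by
  by_contra! hcon
  obtain ⟨hsmall, hall⟩ := hcon
  have hb0 : 0 < b := by positivity
  have hB : 1 < b ^ 2 ^ n := one_lt_pow₀ hb (by positivity)
  let v : ℕ → ℝ := fun j => if j < n then b ^ 2 ^ j else b ^ 2 ^ n - 1
  have hv (j : ℕ) : 0 < v j := by
    simp only [v]
    split_ifs
    · positivity
    · linarith
  have hvprod {m : ℕ} (hm : m ≤ n) : ∏ j ∈ range m, v j = ∏ j ∈ range m, b ^ 2 ^ j :=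
    prod_congr rfl fun j hj => if_pos ((mem_range.1 hj).trans_le hm)
  have hvn : v n = b ^ 2 ^ n - 1 := if_neg (lt_irrefl n)
  have hlt := prod_one_add_inv_lt_of_prod_le hu hv hmono (n + 1)
    (fun m hm => by
      rcases Nat.eq_zero_or_pos m with rfl | hm0
      · simp
      · rw [hvprod (Nat.lt_succ_iff.1 hm), ← mul_le_mul_iff_right₀ hb0, mul_prod_pow_two_pow]
        exact (hsmall m hm0 (Nat.lt_succ_iff.1 hm)).le)
    (by
      rw [← mul_lt_mul_iff_right₀ hb0, prod_range_succ v, hvprod le_rfl, ← mul_assoc,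
        mul_prod_pow_two_pow, hvn]
      refine lt_of_eq_of_lt ?_ hall
      ring)
  have htel : (b - 1) * ∏ j ∈ range (n + 1), (1 + 1 / v j) = b := by
    have hcongr : ∏ j ∈ range n, (1 + 1 / v j) = ∏ j ∈ range n, (1 + 1 / b ^ 2 ^ j) :=
      prod_congr rfl fun j hj => by simp only [v, if_pos (mem_range.1 hj)]
    rw [prod_range_succ, hcongr, ← mul_assoc, prod_one_add_inv_pow_two_pow hb, hvn]
    have : b ^ 2 ^ n - 1 ≠ 0 := by linarith
    field_simp
    ring
  have := mul_lt_mul_of_pos_left hlt (sub_pos.2 hb)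
  linarith

open Finset in
/-- Bound on the solutions of `∑ i, A i * ∏ (1 + 1 / u j) = b` in nondecreasing positive
integers `u j`, where in the `i`-th term `j` runs over the indices related to `i`. -/
lemma mul_prod_le_of_sum_mul_prod_eq {ι : Type*} [Fintype ι] (n : ℕ) (A : ι → ℕ) (b : ℕ)
    (u : ℕ → ℕ) (R : ι → ℕ → Prop) [∀ i j, Decidable (R i j)] (hA : ∀ i, 0 < A i)
    (hu : ∀ j, 0 < u j) (hmono : Monotone u) (hR : ∀ j, ∃ i, R i j)
    (h : ∑ i, (A i : ℝ) * ∏ j ∈ range (n + 1), (if R i j then 1 + 1 / (u j : ℝ) else 1) = b) :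
    (b : ℝ) * ∏ j ∈ range (n + 1), (u j : ℝ) ≤ (b : ℝ) ^ 2 ^ (n + 1) - (b : ℝ) ^ 2 ^ n := by
  induction n using Nat.strong_induction_on generalizing A b u R with
  | _ n ih =>
  have hu' (j : ℕ) : (0 : ℝ) < u j := by exact_mod_cast hu j
  have hterm (i : ι) (j : ℕ) : (1 : ℝ) ≤ if R i j then 1 + 1 / (u j : ℝ) else 1 := by
    have := hu' j
    split_ifs
    · simp
    · exact le_rfl
  have hone (i : ι) : (1 : ℝ) ≤ ∏ j ∈ range (n + 1), (if R i j then 1 + 1 / (u j : ℝ) else 1) :=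
    one_le_prod fun j _ => hterm i j
  obtain ⟨i₀, hi₀⟩ := hR 0
  have hA' (i : ι) : (0 : ℝ) < A i := by exact_mod_cast hA i
  have hsumlt : ∑ i, A i < b := by
    have : (∑ i, (A i : ℝ)) < b := by
      rw [← h]
      refine sum_lt_sum (fun i _ => le_mul_of_one_le_right (hA' i).le (hone i))
        ⟨i₀, mem_univ _, lt_mul_of_one_lt_right (hA' i₀) ?_⟩
      rw [prod_range_succ']
      refine one_lt_mul_of_le_of_lt (one_le_prod fun j _ => hterm i₀ _) ?_
      rw [if_pos hi₀]
      have : 0 < 1 / (u 0 : ℝ) := one_div_pos.2 (hu' 0)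
      linarith
    exact_mod_cast this
  have hsumpos : 0 < ∑ i, A i :=
    (hA i₀).trans_le (single_le_sum (f := A) (fun _ _ => Nat.zero_le _) (mem_univ i₀))
  have hb : (1 : ℝ) < b := by exact_mod_cast (by omega : 1 < b)
  have hbound : (b : ℝ) ≤ (b - 1) * ∏ j ∈ range (n + 1), (1 + 1 / (u j : ℝ)) := by
    have h₁ : (∑ i, (A i : ℝ)) ≤ b - 1 := by
      have : ((∑ i, A i : ℕ) : ℝ) + 1 ≤ b := by exact_mod_cast hsumlt
      push_cast at this
      linarith
    have hP : (0 : ℝ) ≤ ∏ j ∈ range (n + 1), (1 + 1 / (u j : ℝ)) :=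
      prod_nonneg fun j _ => by have := hu' j; positivity
    refine le_trans ?_ (mul_le_mul_of_nonneg_right h₁ hP)
    rw [← h, sum_mul]
    refine sum_le_sum fun i _ => mul_le_mul_of_nonneg_left ?_ (hA' i).le
    refine prod_le_prod (fun j _ => zero_le_one.trans (hterm i j)) fun j _ => ?_
    have := hu' j
    split_ifs
    · exact le_rfl
    · simp
  rcases exists_prod_le_or_prod_le hu' (fun i j hij => by exact_mod_cast hmono hij) hb n hbound
    with ⟨l, hl1, hln, hl⟩ | hall
  · obtain ⟨m, rfl⟩ := Nat.exists_eq_add_of_le hln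
    have key := ih m (by omega)
      (fun i => A i * ∏ j ∈ range l, (if R i j then u j + 1 else u j))
      (b * ∏ j ∈ range l, u j) (fun j => u (l + j)) (fun i j => R i (l + j))
      (fun i => Nat.mul_pos (hA i) (prod_pos fun j _ => by
        have := hu j
        split_ifs <;> omega))
      (fun j => hu _) (fun i j hij => hmono (by omega)) (fun j => hR _)
      (by
        push_cast
        rw [← h, sum_mul]
        refine sum_congr rfl fun i _ => ?_
        rw [add_assoc, prod_range_add _ l (m + 1), mul_assoc, mul_assoc]
        congr 1
        rw [mul_right_comm, ← prod_mul_distrib]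
        congr 1
        refine prod_congr rfl fun j _ => ?_
        have := (hu' j).ne'
        split_ifs
        · field_simp
        · rw [one_mul])
    push_cast at key
    have hc : (b : ℝ) * ∏ j ∈ range (l + m + 1), (u j : ℝ) =
        b * (∏ j ∈ range l, (u j : ℝ)) * ∏ j ∈ range (m + 1), (u (l + j) : ℝ) := by
      rw [add_assoc, prod_range_add, mul_assoc]
    rw [hc]
    set x : ℝ := b * ∏ j ∈ range l, (u j : ℝ) with hx
    have hx1 : 1 ≤ x ^ 2 ^ m := by
      refine one_le_pow₀ (one_le_mul_of_one_le_of_one_le hb.le ?_)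
      exact one_le_prod fun j _ => by exact_mod_cast hu j
    have hy : x ^ 2 ^ m ≤ (b : ℝ) ^ 2 ^ (l + m) := by
      rw [pow_add 2 l m, pow_mul]
      exact pow_le_pow_left₀ (by positivity) hl _
    have e₁ : x ^ 2 ^ (m + 1) = (x ^ 2 ^ m) ^ 2 := by rw [pow_succ 2 m, pow_mul]
    have e₂ : (b : ℝ) ^ 2 ^ (l + m + 1) = ((b : ℝ) ^ 2 ^ (l + m)) ^ 2 := by
      rw [pow_succ 2 (l + m), pow_mul]
    rw [e₁] at key
    rw [e₂]
    nlinarith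
  · exact hall

open Finset in
/-- Unordered version of `mul_prod_le_of_sum_mul_prod_eq`. -/
lemma mul_prod_le_of_sum_mul_finset_prod_eq {ι α : Type*} [Fintype ι] (S : Finset α)
    (hS : S.Nonempty) (A : ι → ℕ) (b : ℕ) (u : α → ℕ) (R : ι → α → Prop)
    [∀ i j, Decidable (R i j)] (hA : ∀ i, 0 < A i)
    (hu : ∀ a ∈ S, 0 < u a) (hR : ∀ a ∈ S, ∃ i, R i a)
    (h : ∑ i, (A i : ℝ) * ∏ a ∈ S, (if R i a then 1 + 1 / (u a : ℝ) else 1) = b) :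
    (b : ℝ) * ∏ a ∈ S, (u a : ℝ) ≤ (b : ℝ) ^ 2 ^ #S - (b : ℝ) ^ 2 ^ (#S - 1) := by
  obtain ⟨n, hn⟩ := Nat.exists_eq_add_of_lt hS.card_pos
  rw [zero_add] at hn
  let e : Fin (n + 1) ≃ S := (S.equivFinOfCardEq hn).symm
  let s : Equiv.Perm (Fin (n + 1)) := Tuple.sort fun j => u (e j)
  have hs : Monotone fun j => u (e (s j)) := Tuple.monotone_sort fun j => u (e j)
  let t : ℕ → S := fun j => e (s ⟨min j n, by omega⟩)
  have hprod (f : α → ℝ) : ∏ j ∈ range (n + 1), f (t j) = ∏ a ∈ S, f a := by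
    rw [← Fin.prod_univ_eq_prod_range (fun j => f (t j)), ← prod_coe_sort S f,
      ← (s.trans e).prod_comp fun a : S => f a]
    refine prod_congr rfl fun j _ => ?_
    have : (⟨min (j : ℕ) n, by omega⟩ : Fin (n + 1)) = j := Fin.ext (by simp; omega)
    simp only [t, this, Equiv.trans_apply]
  have key := mul_prod_le_of_sum_mul_prod_eq n A b (fun j => u (t j)) (fun i j => R i (t j)) hA
    (fun j => hu _ (t j).2)
    (fun i j hij => hs (Fin.mk_le_mk.2 (min_le_min_right n hij)))
    (fun j => hR _ (t j).2)
    (by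
      rw [← h]
      exact sum_congr rfl fun i _ => by
        rw [← hprod fun a => if R i a then 1 + 1 / (u a : ℝ) else 1])
  rw [hprod fun a => (u a : ℝ)] at key
  rw [hn]
  exact key

lemma sigma_mul_PhiS_primeFactors {n : ℕ} (hn : n ≠ 0) :
    sigma n * PhiS n.primeFactors =
      ∏ p ∈ n.primeFactors, (p ^ (n.factorization p + 1) - 1) := by
  rw [sigma, PhiS, Nat.sum_divisors hn, ← Finset.prod_mul_distrib]
  exact Finset.prod_congr rfl fun p hp =>
    geom_sum_mul_of_one_le (Nat.prime_of_mem_primeFactors hp).one_le _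

lemma div_sigma_eq_prod_primeFactors {n : ℕ} (hn : n ≠ 0) :
    (n : ℝ) / sigma n = ∏ p ∈ n.primeFactors,
      (((p - 1 : ℕ) : ℝ) / p * (1 + 1 / ((p ^ (n.factorization p + 1) - 1 : ℕ) : ℝ))) := by
  have hprod : (n : ℝ) = ∏ p ∈ n.primeFactors, (p : ℝ) ^ n.factorization p := by
    conv_lhs => rw [← Nat.prod_factorization_pow_eq_self hn]
    rw [Nat.prod_factorization_eq_prod_primeFactors]
    push_cast
    rfl
  have hsigma : (sigma n : ℝ) =
      ∏ p ∈ n.primeFactors, ∑ k ∈ Finset.range (n.factorization p + 1), (p : ℝ) ^ k := by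
    rw [sigma, Nat.sum_divisors hn]
    push_cast
    rfl
  rw [hsigma]
  conv_lhs => rw [hprod]
  rw [← Finset.prod_div_distrib]
  refine Finset.prod_congr rfl fun p hp => ?_
  have hp1 := (Nat.prime_of_mem_primeFactors hp).one_lt
  have hp1' : (1 : ℝ) < p := by exact_mod_cast hp1
  have hp0 : (p : ℝ) ≠ 0 := by positivity
  have hpow : (p : ℝ) ^ (n.factorization p + 1) - 1 ≠ 0 :=
    (sub_pos.2 (one_lt_pow₀ hp1' (Nat.succ_ne_zero _))).ne'
  have hsub : (p : ℝ) - 1 ≠ 0 := (sub_pos.2 hp1').ne'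
  rw [geom_sum_eq hp1'.ne', Nat.cast_sub hp1.le, Nat.cast_sub (Nat.one_le_pow _ _ (by omega))]
  push_cast
  field_simp
  ring

lemma factorization_prod_eq_of_dvd {ι : Type*} [Fintype ι] {M : ι → ℕ} (hM : ∀ i, M i ≠ 0)
    (hcop : Pairwise fun i j => (M i).Coprime (M j)) {p : ℕ} (hp : p.Prime) {i : ι}
    (hi : p ∣ M i) : (∏ j, M j).factorization p = (M i).factorization p := by
  rw [Nat.factorization_prod fun j _ => hM j, Finsupp.finsetSum_apply]
  refine Finset.sum_eq_single i (fun j _ hj => ?_) fun h => absurd (Finset.mem_univ i) h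
  exact Nat.factorization_eq_zero_of_not_dvd fun hpj =>
    hp.one_lt.ne' (Nat.eq_one_of_dvd_coprimes (hcop hj) hpj hi)

open Finset in
lemma PiS_mul_div_sigma {ι : Type*} [Fintype ι] {M : ι → ℕ} (hM : ∀ i, M i ≠ 0)
    (hcop : Pairwise fun i j => (M i).Coprime (M j)) (i : ι) :
    ((∏ p ∈ (∏ j, M j).primeFactors, (if p ∣ M i then p - 1 else p) : ℕ) : ℝ) *
        ∏ p ∈ (∏ j, M j).primeFactors, (if p ∣ M i then
          1 + 1 / ((p ^ ((∏ j, M j).factorization p + 1) - 1 : ℕ) : ℝ) else 1) =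
      (PiS (∏ j, M j).primeFactors : ℝ) * ((M i : ℝ) / sigma (M i)) := by
  have hN : ∏ j, M j ≠ 0 := prod_ne_zero_iff.2 fun j _ => hM j
  have hfilter : (M i).primeFactors = {p ∈ (∏ j, M j).primeFactors | p ∣ M i} := by
    ext p
    simp only [Nat.mem_primeFactors, mem_filter]
    exact ⟨fun h => ⟨⟨h.1, h.2.1.trans (dvd_prod_of_mem M (mem_univ i)), hN⟩, h.2.1⟩,
      fun h => ⟨h.1.1, h.2, hM i⟩⟩
  rw [div_sigma_eq_prod_primeFactors (hM i), hfilter, prod_filter, PiS]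
  push_cast
  rw [← prod_mul_distrib, ← prod_mul_distrib]
  refine prod_congr rfl fun p hp => ?_
  have hprime := Nat.prime_of_mem_primeFactors hp
  have hp0 : (p : ℝ) ≠ 0 := by exact_mod_cast hprime.ne_zero
  split_ifs with h
  · rw [factorization_prod_eq_of_dvd hM hcop hprime h]
    field_simp
  · rfl

theorem amicable_tuples_stmt13 (k : ℕ) (hk : 2 ≤ k) (M : Fin k → ℕ)
    (hpos : ∀ i, 0 < M i) (hdist : Function.Injective M)
    (hanarchy : ∀ i j, i ≠ j → Nat.gcd (M i) (M j * sigma (M j)) = 1)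
    (hharm : ∑ i, (M i : ℝ) / (sigma (M i) : ℝ) = 1)
    (K : ℕ) (hK : K = (∏ i, M i).primeFactors.card) :
    (sigma (∏ i, M i) : ℝ) * (PhiS (∏ i, M i).primeFactors : ℝ) /
        (PiS (∏ i, M i).primeFactors : ℝ) ≤
      F K ((PiS (∏ i, M i).primeFactors : ℝ)) * ((PiS (∏ i, M i).primeFactors : ℝ)) ^ (-2 : ℤ) := by
  set N := ∏ i, M i with hNdef
  have hM (i : Fin k) : M i ≠ 0 := (hpos i).ne'
  have hN : N ≠ 0 := Finset.prod_ne_zero_iff.2 fun i _ => hM i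
  have hcop : Pairwise fun i j => (M i).Coprime (M j) := fun i j hij =>
    Nat.Coprime.coprime_mul_right_right (hanarchy i j hij)
  have hne : N.primeFactors.Nonempty := by
    rw [Nat.nonempty_primeFactors]
    refine lt_of_le_of_ne (Nat.one_le_iff_ne_zero.2 hN) fun h1 => ?_
    have hM1 (i : Fin k) : M i = 1 :=
      Nat.dvd_one.1 (h1 ▸ Finset.dvd_prod_of_mem M (Finset.mem_univ i))
    have := hdist ((hM1 ⟨0, by omega⟩).trans (hM1 ⟨1, by omega⟩).symm)
    simp at this
  have key := mul_prod_le_of_sum_mul_finset_prod_eq N.primeFactors hne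
    (fun i => ∏ p ∈ N.primeFactors, if p ∣ M i then p - 1 else p) (PiS N.primeFactors)
    (fun p => p ^ (N.factorization p + 1) - 1) (fun i p => p ∣ M i)
    (fun i => Finset.prod_pos fun p hp => by
      have := (Nat.prime_of_mem_primeFactors hp).one_lt
      split_ifs <;> omega)
    (fun p hp => Nat.sub_pos_of_lt
      (Nat.one_lt_pow (Nat.succ_ne_zero _) (Nat.prime_of_mem_primeFactors hp).one_lt))
    (fun p hp => by
      obtain ⟨i, -, hi⟩ := (Nat.prime_of_mem_primeFactors hp).prime.exists_mem_finset_dvd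
        (Nat.dvd_of_mem_primeFactors hp)
      exact ⟨i, hi⟩)
    (by
      rw [Finset.sum_congr rfl fun i _ => PiS_mul_div_sigma hM hcop i, ← Finset.mul_sum, hharm,
        mul_one])
  have hb : (0 : ℝ) < PiS N.primeFactors := by
    exact_mod_cast Finset.prod_pos fun p hp => (Nat.prime_of_mem_primeFactors hp).pos
  rw [← Nat.cast_prod, ← sigma_mul_PhiS_primeFactors hN, Nat.cast_mul] at key
  rw [F, if_neg (hK ▸ hne.card_ne_zero), hK, zpow_neg, ← div_eq_mul_inv,
    div_le_div_iff₀ hb (zpow_pos hb 2)]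
  rw [show (2 : ℤ) = (2 : ℕ) from rfl, zpow_natCast]
  calc _ = (PiS N.primeFactors : ℝ) * (sigma N * PhiS N.primeFactors) * PiS N.primeFactors := by
        ring
    _ ≤ _ := mul_le_mul_of_nonneg_right key hb.le
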